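/- Let M ∈ ℝ^{2n×2n} be symmetric positive-definite and let S ∈ Sp(2n) satisfy SᵀMS = diag(D, D) with D = diag(d₁, ..., dₙ) positive diagonal. Then X ∈ Sp(2n) is a global minimizer of f(X) = tr(XᵀMX) over Sp(2n) if and only if X = SK for some orthosymplectic K ∈ OrSp(2n); i.e., the set of global minimizers of the problem with k = n is exactly S·OrSp(2n). -/

import Mathlib

open Matrix

noncomputable section

/-- Index type for `2n`-dimensional objects: first copy for indices `1..n`,
second copy for indices `n+1..2n`. -/
abbrev Idx (n : ℕ) := Fin n ⊕ Fin n

/-- The Poisson matrix `J_{2n} = [[0, I], [-I, 0]]`. -/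
def Jmat (n : ℕ) : Matrix (Idx n) (Idx n) ℝ := fromBlocks 0 1 (-1) 0

/-- `X ∈ Sp(2k, 2n)`, i.e. `Xᵀ J_{2n} X = J_{2k}`. -/
def Symplectic {n k : ℕ} (X : Matrix (Idx n) (Idx k) ℝ) : Prop :=
  Xᵀ * Jmat n * X = Jmat k

/-- `K ∈ OrSp(2n)`, i.e. `KᵀK = I` and `Kᵀ J K = J`. -/
def OrthoSymplectic {n : ℕ} (K : Matrix (Idx n) (Idx n) ℝ) : Prop :=
  Kᵀ * K = 1 ∧ Symplectic K

/-- The block-diagonal matrix `diag(D, D)` with `D = diagonal d`. -/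
def diagPair {n : ℕ} (d : Fin n → ℝ) : Matrix (Idx n) (Idx n) ℝ :=
  fromBlocks (diagonal d) 0 0 (diagonal d)

/-- The matrix `[[0, -Λ], [Λ, 0]]` with `Λ = diagonal lam`. -/
def offPair {k : ℕ} (lam : Fin k → ℝ) : Matrix (Idx k) (Idx k) ℝ :=
  fromBlocks 0 (-(diagonal lam)) (diagonal lam) 0

theorem Jmat_eq_neg_J (n : ℕ) : Jmat n = -Matrix.J (Fin n) ℝ := by
  simp [Jmat, Matrix.J, fromBlocks_neg]

theorem Jmat_transpose (n : ℕ) : (Jmat n)ᵀ = -Jmat n := by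
  rw [Jmat_eq_neg_J, transpose_neg, J_transpose]

theorem Jmat_mul_self (n : ℕ) : Jmat n * Jmat n = -1 := by
  rw [Jmat_eq_neg_J, neg_mul_neg, J_squared]

theorem symplectic_iff_mem {n : ℕ} {X : Matrix (Idx n) (Idx n) ℝ} :
    Symplectic X ↔ X ∈ symplecticGroup (Fin n) ℝ := by
  rw [SymplecticGroup.mem_iff', Symplectic, Jmat_eq_neg_J, mul_neg, neg_mul, neg_inj]

theorem Symplectic.mul_Jmat_mul_transpose {n : ℕ} {X : Matrix (Idx n) (Idx n) ℝ}
    (hX : Symplectic X) : X * Jmat n * Xᵀ = Jmat n := by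
  have h := symplectic_iff_mem.2 (SymplecticGroup.transpose_mem (symplectic_iff_mem.1 hX))
  rwa [Symplectic, transpose_transpose] at h

theorem Symplectic.exists_eq_mul {n : ℕ} {S X : Matrix (Idx n) (Idx n) ℝ}
    (hS : Symplectic S) (hX : Symplectic X) : ∃ K, Symplectic K ∧ X = S * K := by
  let S' : symplecticGroup (Fin n) ℝ := ⟨S, symplectic_iff_mem.1 hS⟩
  let X' : symplecticGroup (Fin n) ℝ := ⟨X, symplectic_iff_mem.1 hX⟩
  refine ⟨(S'⁻¹ * X' : symplecticGroup (Fin n) ℝ),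
    symplectic_iff_mem.2 (S'⁻¹ * X').2, ?_⟩
  exact congrArg Subtype.val (mul_inv_cancel_left S' X').symm

theorem diagPair_eq_diagonal {n : ℕ} (d : Fin n → ℝ) :
    diagPair d = diagonal (Sum.elim d d) := by
  simp [diagPair, fromBlocks_diagonal]

theorem diagPair_mul_Jmat {n : ℕ} (d : Fin n → ℝ) :
    diagPair d * Jmat n = Jmat n * diagPair d := by
  simp only [diagPair, Jmat, fromBlocks_multiply]
  simp

theorem diagPair_transpose {n : ℕ} (d : Fin n → ℝ) : (diagPair d)ᵀ = diagPair d := by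
  simp [diagPair_eq_diagonal]

theorem trace_transpose_mul_diagonal_mul {ι κ : Type*} [Fintype ι] [DecidableEq ι] [Fintype κ]
    (δ : ι → ℝ) (E : Matrix ι κ ℝ) :
    (Eᵀ * diagonal δ * E).trace = ∑ j, ∑ i, δ i * E i j ^ 2 := by
  simp only [trace, diag_apply, mul_apply (M := Eᵀ * diagonal δ), mul_diagonal, transpose_apply]
  exact Finset.sum_congr rfl fun j _ => Finset.sum_congr rfl fun i _ => by ring

theorem trace_transpose_mul_diagonal_mul_nonneg {ι κ : Type*} [Fintype ι] [DecidableEq ι]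
    [Fintype κ] {δ : ι → ℝ} (hδ : ∀ i, 0 ≤ δ i) (E : Matrix ι κ ℝ) :
    0 ≤ (Eᵀ * diagonal δ * E).trace := by
  rw [trace_transpose_mul_diagonal_mul]
  exact Finset.sum_nonneg fun j _ => Finset.sum_nonneg fun i _ =>
    mul_nonneg (hδ i) (sq_nonneg _)

theorem eq_zero_of_trace_transpose_mul_diagonal_mul_nonpos {ι κ : Type*} [Fintype ι]
    [DecidableEq ι] [Fintype κ] {δ : ι → ℝ} (hδ : ∀ i, 0 < δ i) {E : Matrix ι κ ℝ}
    (hE : (Eᵀ * diagonal δ * E).trace ≤ 0) : E = 0 := by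
  have h := hE.antisymm (trace_transpose_mul_diagonal_mul_nonneg (fun i => (hδ i).le) E)
  have hterm : ∀ i j, 0 ≤ δ i * E i j ^ 2 := fun i j => mul_nonneg (hδ i).le (sq_nonneg _)
  rw [trace_transpose_mul_diagonal_mul,
    Finset.sum_eq_zero_iff_of_nonneg fun j _ => Finset.sum_nonneg fun i _ => hterm i j] at h
  ext i j
  have hij := (Finset.sum_eq_zero_iff_of_nonneg fun i _ => hterm i j).1
    (h j (Finset.mem_univ j)) i (Finset.mem_univ i)
  simpa [(hδ i).ne'] using hij

/-- The excess of `tr(Kᵀ diag(D, D) K)` over its minimum is measured by the failure of `K` to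
commute with the Poisson matrix. -/
theorem Symplectic.trace_excess {n : ℕ} {K : Matrix (Idx n) (Idx n) ℝ} (hK : Symplectic K)
    (d : Fin n → ℝ) :
    ((K + Jmat n * K * Jmat n)ᵀ * diagPair d * (K + Jmat n * K * Jmat n)).trace =
      2 * ((Kᵀ * diagPair d * K).trace - (diagPair d).trace) := by
  set J := Jmat n
  set A := diagPair d
  have hJt : Jᵀ = -J := Jmat_transpose n
  have hJJ : J * J = -1 := Jmat_mul_self n
  have hAJ : A * J = J * A := diagPair_mul_Jmat d
  have hcross : (Kᵀ * A * (J * K * J)).trace = -A.trace := by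
    calc (Kᵀ * A * (J * K * J)).trace = (A * J * (K * J * Kᵀ)).trace := by
          rw [Matrix.mul_assoc, trace_mul_comm]
          simp only [Matrix.mul_assoc]
      _ = -A.trace := by
          rw [hK.mul_Jmat_mul_transpose, Matrix.mul_assoc, hJJ, mul_neg, mul_one, trace_neg]
  have hcross' : ((J * K * J)ᵀ * A * K).trace = -A.trace := by
    rw [← hcross, ← trace_transpose]
    simp only [transpose_mul, transpose_transpose, A, diagPair_transpose, Matrix.mul_assoc]
  have hquad : ((J * K * J)ᵀ * A * (J * K * J)).trace = (Kᵀ * A * K).trace := by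
    calc ((J * K * J)ᵀ * A * (J * K * J)).trace
        = (J * (Kᵀ * (J * (A * J)) * K * J)).trace := by
          simp only [transpose_mul, hJt, Matrix.mul_assoc, neg_mul, mul_neg, neg_neg]
      _ = (Kᵀ * A * K).trace := by
          rw [trace_mul_comm, Matrix.mul_assoc _ J J, hAJ, ← Matrix.mul_assoc J J A, hJJ]
          simp only [neg_mul, mul_neg, one_mul, mul_one, neg_neg]
  rw [transpose_add, add_mul, add_mul, mul_add, mul_add, trace_add, trace_add, trace_add,
    hcross, hcross', hquad]
  ring

theorem Symplectic.trace_diagPair_le {n : ℕ} {K : Matrix (Idx n) (Idx n) ℝ} (hK : Symplectic K)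
    {d : Fin n → ℝ} (hd : ∀ j, 0 ≤ d j) :
    (diagPair d).trace ≤ (Kᵀ * diagPair d * K).trace := by
  have h := hK.trace_excess d
  have h0 := trace_transpose_mul_diagonal_mul_nonneg (δ := Sum.elim d d)
    (by rintro (i | i) <;> exact hd i) (K + Jmat n * K * Jmat n)
  rw [← diagPair_eq_diagonal] at h0
  linarith

theorem Symplectic.orthoSymplectic_of_trace_le {n : ℕ} {K : Matrix (Idx n) (Idx n) ℝ}
    (hK : Symplectic K) {d : Fin n → ℝ} (hd : ∀ j, 0 < d j)
    (h : (Kᵀ * diagPair d * K).trace ≤ (diagPair d).trace) : OrthoSymplectic K := by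
  have hE : K + Jmat n * K * Jmat n = 0 := by
    apply eq_zero_of_trace_transpose_mul_diagonal_mul_nonpos (δ := Sum.elim d d)
    · rintro (i | i) <;> exact hd i
    · rw [← diagPair_eq_diagonal, hK.trace_excess d]
      linarith
  refine ⟨?_, hK⟩
  calc Kᵀ * K = -(Kᵀ * Jmat n * K * Jmat n) := by
        nth_rewrite 2 [eq_neg_of_add_eq_zero_left hE]
        simp only [mul_neg, Matrix.mul_assoc]
    _ = 1 := by rw [hK, Jmat_mul_self, neg_neg]

theorem OrthoSymplectic.trace_transpose_mul_mul {n : ℕ} {K : Matrix (Idx n) (Idx n) ℝ}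
    (hK : OrthoSymplectic K) (A : Matrix (Idx n) (Idx n) ℝ) : (Kᵀ * A * K).trace = A.trace := by
  rw [trace_mul_comm, ← Matrix.mul_assoc, mul_eq_one_comm.1 hK.1, one_mul]

theorem transpose_mul_mul_mul {n : ℕ} (M S K : Matrix (Idx n) (Idx n) ℝ) :
    (S * K)ᵀ * M * (S * K) = Kᵀ * (Sᵀ * M * S) * K := by
  simp only [transpose_mul, Matrix.mul_assoc]

/-- for `k = n`, the set of global minimizers of `tr(XᵀMX)` over
`Sp(2n)` is exactly `S·OrSp(2n)`, where `S` symplectically diagonalizes `M`. -/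
theorem global_minimizers_k_eq_n {n : ℕ}
    (M S : Matrix (Idx n) (Idx n) ℝ) (hM : M.PosDef) (hS : Symplectic S)
    (d : Fin n → ℝ) (hd : ∀ j, 0 < d j) (hdiag : Sᵀ * M * S = diagPair d)
    (X : Matrix (Idx n) (Idx n) ℝ) (hX : Symplectic X) :
    (∀ Y : Matrix (Idx n) (Idx n) ℝ, Symplectic Y →
        (Xᵀ * M * X).trace ≤ (Yᵀ * M * Y).trace) ↔
      ∃ K : Matrix (Idx n) (Idx n) ℝ, OrthoSymplectic K ∧ X = S * K := by
  obtain ⟨K, hK, rfl⟩ := hS.exists_eq_mul hX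
  rw [transpose_mul_mul_mul, hdiag]
  constructor
  · intro hmin
    have h := hmin S hS
    rw [hdiag] at h
    exact ⟨K, hK.orthoSymplectic_of_trace_le hd h, rfl⟩
  · rintro ⟨L, hL, hKL⟩ Y hY
    obtain ⟨N, hN, rfl⟩ := hS.exists_eq_mul hY
    rw [← hdiag, ← transpose_mul_mul_mul, hKL, transpose_mul_mul_mul, transpose_mul_mul_mul,
      hdiag, hL.trace_transpose_mul_mul]
    exact hN.trace_diagPair_le fun j => (hd j).le
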